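/- arXiv:0901.1099 — 3 statements merged into one kernel-verified Lean document; each statement's English description precedes it below -/
import Mathlib

section
/- Let (Ω, 𝒜, Q) be a probability space, t < T real numbers, τ : Ω → ℝ a random (default) time, and ℱ ⊆ 𝒢 ⊆ 𝒜 sub-σ-algebras (ℱ the market information at the valuation time t, 𝒢 the information at the default time). Assume {τ > t} ∈ ℱ and {t < τ ≤ T} ∈ 𝒢. Let Π_tT, Π_tτ, Π_τT be integrable real random variables (the discounted default-free cash flows over [t,T], over [t,τ], and over [τ,T] respectively), let D be a nonnegative bounded 𝒢-measurable random variable (the discount factor D(t,τ)), and set N := E[Π_τT | 𝒢] (the NPV at default). Assume the pathwise cash-flow decomposition Π_tT = Π_tτ + D·Π_τT holds a.e. on {t < τ ≤ T}, and that all products appearing below are integrable. Fix a deterministic recovery REC ∈ [0,1] and set LGD := 1 − REC. Define the counterparty-risky discounted payoff Π^D := 1_{τ>T}·Π_tT + 1_{t<τ≤T}·( Π_tτ + D·( REC·max(N,0) − max(−N,0) ) ). Then almost everywhere on the event {τ > t}: E[Π^D | ℱ] = E[Π_tT | ℱ] − LGD·E[ 1_{t<τ≤T}·D·max(N,0) |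 ℱ ]. -/
open MeasureTheory ProbabilityTheory Set

/-- **General counterparty-risk credit-valuation adjustment (CR-CVA) formula.**
On the event `{τ > t}`, the price of the counterparty-risky payoff `Π^D` equals the
default-free price minus the positive CR-CVA term `LGD · E[1_{t<τ≤T} · D · (NPV(τ))⁺ | ℱ]`,
where `LGD = 1 - REC` and `NPV(τ) = N = E[Π_τT | 𝒢]`. -/
theorem cr_cva_formula
    {Ω : Type*} {mA : MeasurableSpace Ω} (μ : Measure Ω) [IsProbabilityMeasure μ]
    (mF mG : MeasurableSpace Ω) (hFG : mF ≤ mG) (hGA : mG ≤ mA)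
    (t T : ℝ) (htT : t < T) (τ : Ω → ℝ)
    (hτt : MeasurableSet[mF] {ω | t < τ ω})
    (hdef : MeasurableSet[mG] {ω | t < τ ω ∧ τ ω ≤ T})
    (PitT Pittau PitauT : Ω → ℝ)
    (hPitT : Integrable PitT μ) (hPittau : Integrable Pittau μ)
    (hPitauT : Integrable PitauT μ)
    (D : Ω → ℝ) (hDmeas : Measurable[mG] D) (hDnonneg : ∀ ω, 0 ≤ D ω)
    (hDbdd : ∃ C, ∀ ω, D ω ≤ C)
    (N : Ω → ℝ) (hN : N = μ[PitauT | mG])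
    (hdecomp : ∀ᵐ ω ∂μ, (t < τ ω ∧ τ ω ≤ T) → PitT ω = Pittau ω + D ω * PitauT ω)
    (REC : ℝ) (hREC0 : 0 ≤ REC) (hREC1 : REC ≤ 1)
    (PiD : Ω → ℝ)
    (hPiD : ∀ ω, PiD ω =
      ({ω | T < τ ω}.indicator PitT) ω +
      ({ω | t < τ ω ∧ τ ω ≤ T}.indicator
        (fun ω => Pittau ω + D ω * (REC * max (N ω) 0 - max (-(N ω)) 0))) ω)
    (hPiDint : Integrable PiD μ)
    (hCVAint : Integrable
      ({ω | t < τ ω ∧ τ ω ≤ T}.indicator (fun ω => D ω * max (N ω) 0)) μ) :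
    ∀ᵐ ω ∂μ, t < τ ω →
      (μ[PiD | mF]) ω =
        (μ[PitT | mF]) ω -
          (1 - REC) *
            (μ[{ω | t < τ ω ∧ τ ω ≤ T}.indicator (fun ω => D ω * max (N ω) 0) | mF]) ω := by
  obtain ⟨C, hC⟩ := hDbdd
  set A : Set Ω := {ω | t < τ ω} with hA
  set B : Set Ω := {ω | t < τ ω ∧ τ ω ≤ T} with hB
  set V : Ω → ℝ := B.indicator (fun ω => D ω * max (N ω) 0) with hV
  have hFA : mF ≤ mA := hFG.trans hGA
  set K : Ω → ℝ := B.indicator D with hK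
  have hKm : Measurable[mG] K := hDmeas.indicator hdef
  have hKsm : StronglyMeasurable[mG] K := hKm.stronglyMeasurable
  have hKae : AEStronglyMeasurable[mA] K μ := (hKsm.mono hGA).aestronglyMeasurable
  have hKb : ∀ᵐ ω ∂μ, ‖K ω‖ ≤ C := by
    refine Filter.Eventually.of_forall fun ω => ?_
    by_cases h : ω ∈ B
    · simp only [hK, indicator_of_mem h, Real.norm_eq_abs, abs_of_nonneg (hDnonneg ω)]
      exact hC ω
    · simp only [hK, indicator_of_notMem h, norm_zero]
      exact (hDnonneg ω).trans (hC ω)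
  have hNint : Integrable N μ := by rw [hN]; exact integrable_condExp
  have hX : Integrable (K * PitauT) μ := hPitauT.bdd_mul hKae hKb
  have hY : Integrable (K * N) μ := hNint.bdd_mul hKae hKb
  have hXY : μ[K * PitauT | mG] =ᵐ[μ] K * N := by
    rw [hN]
    exact condExp_mul_of_stronglyMeasurable_left hKsm hX hPitauT
  have hXYF : μ[K * PitauT | mF] =ᵐ[μ] μ[K * N | mF] :=
    (condExp_condExp_of_le hFG hGA).symm.trans (condExp_congr_ae hXY)
  have hAint : Integrable (A.indicator PitT) μ := hPitT.indicator (hFA _ hτt)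
  have hdec : PiD =ᵐ[μ] (A.indicator PitT - K * PitauT) + (K * N - (1 - REC) • V) := by
    filter_upwards [hdecomp] with ω hω
    rw [hPiD ω]
    simp only [Pi.add_apply, Pi.sub_apply, Pi.mul_apply, Pi.smul_apply, smul_eq_mul, hV, hK,
      indicator_apply, hA, hB, mem_setOf_eq]
    by_cases h1 : t < τ ω
    · by_cases h2 : τ ω ≤ T
      · have h3 := hω ⟨h1, h2⟩
        have h4 : max (N ω) 0 - max (-(N ω)) 0 = N ω := max_zero_sub_max_neg_zero_eq_self _
        simp only [h1, h2, not_lt.mpr h2, and_self, if_true, if_false]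
        rw [h3]
        linear_combination D ω * h4
      · simp [h1, h2, not_le.mp h2]
    · have : ¬ T < τ ω := fun h => h1 (htT.trans h)
      simp [h1, this]
  have e0 := condExp_congr_ae (m := mF) hdec
  have e1 := condExp_add (hAint.sub hX) (hY.sub (hCVAint.smul (1 - REC))) mF
  have e2 := condExp_sub hAint hX mF
  have e3 := condExp_sub hY (hCVAint.smul (1 - REC)) mF
  have e4 := condExp_smul (μ := μ) (1 - REC) V mF
  have e5 := condExp_indicator hPitT hτt
  filter_upwards [e0, e1, e2, e3, e4, e5, hXYF] with ω h0 h1 h2 h3 h4 h5 h6 hω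
  have hm : ω ∈ A := hω
  simp only [Pi.add_apply, Pi.sub_apply, Pi.smul_apply, smul_eq_mul] at h1 h2 h3 h4
  rw [indicator_of_mem hm] at h5
  rw [h0, h1, h2, h3, h4, h5, h6]
  ring
end

section
/- Under the same hypotheses as the general CR-CVA formula (probability space (Ω, 𝒜, Q), t < T, default time τ, sub-σ-algebras ℱ ⊆ 𝒢 with {τ > t} ∈ ℱ and {t < τ ≤ T} ∈ 𝒢, integrable Π_tT, Π_tτ, Π_τT with Π_tT = Π_tτ + D·Π_τT a.e. on {t < τ ≤ T}, nonnegative bounded 𝒢-measurable discount factor D, N := E[Π_τT | 𝒢], REC ∈ [0,1], and the counterparty-risky payoff Π^D := 1_{τ>T}·Π_tT + 1_{t<τ≤T}·( Π_tτ + D·( REC·max(N,0) − max(−N,0) ) )), one has E[Π^D | ℱ] ≤ E[Π_tT | ℱ] almost everywhere on {τ > t}; that is, the value of a claim subject to counterparty risk is always smaller than or equal to the value of the corresponding claim traded with a default-free counterparty, the difference being the nonnegative counterparty-risk adjustment LGD·E[1_{t<τ≤T}·D·max(N,0) | ℱ] with LGD = 1 − REC. -/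
open MeasureTheory ProbabilityTheory Set

/-- **Counterparty risk decreases the value of a claim.**
Under the hypotheses of the general CR-CVA formula, the value of a claim subject to
counterparty risk is, almost everywhere on `{τ > t}`, smaller than or equal to the value of
the corresponding claim traded with a default-free counterparty:
`E[Π^D | ℱ] ≤ E[Π_tT | ℱ]` a.e. on `{τ > t}`. -/
theorem cr_cva_le_default_free
    {Ω : Type*} {mA : MeasurableSpace Ω} (μ : Measure Ω) [IsProbabilityMeasure μ]
    (mF mG : MeasurableSpace Ω) (hFG : mF ≤ mG) (hGA : mG ≤ mA)
    (t T : ℝ) (htT : t < T) (τ : Ω → ℝ)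
    (hτt : MeasurableSet[mF] {ω | t < τ ω})
    (hdef : MeasurableSet[mG] {ω | t < τ ω ∧ τ ω ≤ T})
    (PitT Pittau PitauT : Ω → ℝ)
    (hPitT : Integrable PitT μ) (hPittau : Integrable Pittau μ)
    (hPitauT : Integrable PitauT μ)
    (D : Ω → ℝ) (hDmeas : Measurable[mG] D) (hDnonneg : ∀ ω, 0 ≤ D ω)
    (hDbdd : ∃ C, ∀ ω, D ω ≤ C)
    (N : Ω → ℝ) (hN : N = μ[PitauT | mG])
    (hdecomp : ∀ᵐ ω ∂μ, (t < τ ω ∧ τ ω ≤ T) → PitT ω = Pittau ω + D ω * PitauT ω)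
    (REC : ℝ) (hREC0 : 0 ≤ REC) (hREC1 : REC ≤ 1)
    (PiD : Ω → ℝ)
    (hPiD : ∀ ω, PiD ω =
      ({ω | T < τ ω}.indicator PitT) ω +
      ({ω | t < τ ω ∧ τ ω ≤ T}.indicator
        (fun ω => Pittau ω + D ω * (REC * max (N ω) 0 - max (-(N ω)) 0))) ω)
    (hPiDint : Integrable PiD μ)
    (hCVAint : Integrable
      ({ω | t < τ ω ∧ τ ω ≤ T}.indicator (fun ω => D ω * max (N ω) 0)) μ) :
    ∀ᵐ ω ∂μ, t < τ ω → (μ[PiD | mF]) ω ≤ (μ[PitT | mF]) ω := by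
  have hFA : mF ≤ mA := hFG.trans hGA
  obtain ⟨C, hC⟩ := hDbdd
  set S : Set Ω := {ω | t < τ ω ∧ τ ω ≤ T} with hS
  set A : Set Ω := {ω | t < τ ω} with hA
  set W : Ω → ℝ := S.indicator D with hW
  have hWm : StronglyMeasurable[mG] W := (hDmeas.indicator hdef).stronglyMeasurable
  have hWA : AEStronglyMeasurable[mA] W μ := (hWm.mono hGA).aestronglyMeasurable
  have hW0 : ∀ ω, 0 ≤ W ω := fun ω => Set.indicator_nonneg (fun x _ => hDnonneg x) ω
  have hWC : ∀ ω, ‖W ω‖ ≤ C := by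
    intro ω
    rw [Real.norm_of_nonneg (hW0 ω)]
    exact (Set.indicator_le_self' (fun x _ => hDnonneg x) ω).trans (hC ω)
  have hNint : Integrable N μ := hN ▸ integrable_condExp
  set K : Ω → ℝ := fun ω => REC * max (N ω) 0 - max (-(N ω)) 0 with hK
  have hKint : Integrable K μ := (hNint.pos_part.const_mul REC).sub hNint.neg_part
  have hX : Integrable (W * PitauT) μ :=
    hPitauT.bdd_mul hWA (Filter.Eventually.of_forall hWC)
  have hH : Integrable (W * K) μ := hKint.bdd_mul hWA (Filter.Eventually.of_forall hWC)
  have hWN : Integrable (W * N) μ := hNint.bdd_mul hWA (Filter.Eventually.of_forall hWC)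
  have hf : Integrable (A.indicator PitT) μ := hPitT.indicator (hFA _ hτt)
  have hle : W * K ≤ᵐ[μ] W * N := by
    refine Filter.Eventually.of_forall fun ω => ?_
    refine mul_le_mul_of_nonneg_left ?_ (hW0 ω)
    simp only [hK]
    rcases le_total (N ω) 0 with h | h
    · rw [max_eq_right h, max_eq_left (by linarith)]; linarith
    · rw [max_eq_left h, max_eq_right (by linarith)]; nlinarith
  have h1 : μ[W * K | mF] ≤ᵐ[μ] μ[W * N | mF] := condExp_mono hH hWN hle
  have h2 : μ[W * PitauT | mG] =ᵐ[μ] W * N := by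
    rw [hN]; exact condExp_mul_of_stronglyMeasurable_left hWm hX hPitauT
  have h3 : μ[W * PitauT | mF] =ᵐ[μ] μ[W * N | mF] :=
    (condExp_condExp_of_le hFG hGA).symm.trans (condExp_congr_ae h2)
  have hdec : PiD =ᵐ[μ] A.indicator PitT + (W * K - W * PitauT) := by
    filter_upwards [hdecomp] with ω hω
    rw [hPiD ω]
    simp only [Pi.add_apply, Pi.sub_apply, Pi.mul_apply, hW, hS, hA, Set.indicator_apply,
      Set.mem_setOf_eq, hK]
    by_cases ha : t < τ ω
    · by_cases hb : τ ω ≤ T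
      · simp only [ha, hb, not_lt.mpr hb, and_self, if_true, if_false, hω ⟨ha, hb⟩]; ring
      · simp [ha, hb, not_le.mp hb]
    · have : ¬ T < τ ω := fun h => ha (htT.trans h)
      simp [ha, this]
  have h4 := condExp_congr_ae (m := mF) hdec
  have h5 := condExp_add hf (hH.sub hX) mF
  have h6 := condExp_sub hH hX mF
  have h7 := condExp_indicator hPitT hτt
  filter_upwards [h1, h3, h4, h5, h6, h7] with ω e1 e3 e4 e5 e6 e7 hω
  rw [e4, e5, Pi.add_apply, e6, Pi.sub_apply, e7, Set.indicator_of_mem (show ω ∈ A from hω), e3]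
  linarith
end

section
/- Let m ∈ ℝ, v > 0, K > 0, and let N(m,v) denote the Gaussian probability measure on ℝ with mean m and variance v. Let Φ denote the cumulative distribution function of the standard Gaussian N(0,1). Then ∫ max(e^x − K, 0) dN(m,v)(x) = exp(m + v/2)·Φ( (m + v − ln K)/√v ) − K·Φ( (m − ln K)/√v ). -/
open MeasureTheory ProbabilityTheory Set
open scoped NNReal

lemma black_tail (a : ℝ) (v : ℝ≥0) (hv : 0 < v) (L : ℝ) :
    (gaussianReal a v).real (Ici L)
      = cdf (gaussianReal 0 1) ((a - L) / Real.sqrt (v : ℝ)) := by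
  have hv' : (0 : ℝ) < v := hv
  have hs : 0 < Real.sqrt (v : ℝ) := Real.sqrt_pos.mpr hv'
  have hmap : (gaussianReal a v).map (fun x => (a - x) / Real.sqrt (v : ℝ)) = gaussianReal 0 1 := by
    have h1 : (fun x : ℝ => (a - x) / Real.sqrt (v : ℝ))
        = (fun x => x / Real.sqrt (v : ℝ)) ∘ (fun x => a - x) := rfl
    rw [h1, ← Measure.map_map (by fun_prop) (by fun_prop), gaussianReal_map_const_sub,
      gaussianReal_map_div_const]
    congr 1
    · simp
    · ext
      simp [Real.sq_sqrt hv'.le, hv'.ne']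
  rw [cdf_eq_real, ← hmap, map_measureReal_apply (by fun_prop) measurableSet_Iic]
  congr 1
  ext x
  simp only [mem_Ici, mem_preimage, mem_Iic]
  rw [div_le_div_iff_of_pos_right hs]
  constructor <;> intro h <;> linarith

lemma black_shift (m : ℝ) (v : ℝ≥0) (hv : 0 < v) (L : ℝ) :
    ∫ x in Ici L, Real.exp x ∂(gaussianReal m v)
      = Real.exp (m + (v : ℝ) / 2) * (gaussianReal (m + v) v).real (Ici L) := by
  have hv' : (0 : ℝ) < v := hv
  rw [← integral_indicator measurableSet_Ici, ← integral_indicator_one measurableSet_Ici,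
    integral_gaussianReal_eq_integral_smul hv.ne', integral_gaussianReal_eq_integral_smul hv.ne',
    ← integral_const_mul]
  congr 1
  ext x
  by_cases hx : x ∈ Ici L
  · simp only [indicator_of_mem hx, smul_eq_mul, gaussianPDFReal, Pi.one_apply, mul_one]
    rw [mul_assoc, ← Real.exp_add, mul_left_comm, ← Real.exp_add]
    congr 2
    field_simp
    ring
  · simp [indicator_of_notMem hx]

/-- **Black-type formula for a call on a lognormal price.**
For a Gaussian measure `N(m, v)` on `ℝ` with `v > 0` and a strike `K > 0`,
`∫ (e^x − K)⁺ dN(m,v)(x) = e^{m+v/2}·Φ((m+v−ln K)/√v) − K·Φ((m−ln K)/√v)`,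
where `Φ` is the standard Gaussian cumulative distribution function. -/
theorem black_formula_lognormal_call
    (m : ℝ) (v : ℝ≥0) (hv : 0 < v) (K : ℝ) (hK : 0 < K) :
    ∫ x, max (Real.exp x - K) 0 ∂(gaussianReal m v)
      = Real.exp (m + (v : ℝ) / 2) *
          cdf (gaussianReal 0 1) ((m + (v : ℝ) - Real.log K) / Real.sqrt (v : ℝ))
        - K * cdf (gaussianReal 0 1) ((m - Real.log K) / Real.sqrt (v : ℝ)) := by
  have hint : Integrable (fun x => Real.exp x) (gaussianReal m v) := by
    simpa using integrable_exp_mul_gaussianReal (μ := m) (v := v) 1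
  have h : ∀ x, max (Real.exp x - K) 0
      = (Ici (Real.log K)).indicator (fun x => Real.exp x - K) x := by
    intro x
    by_cases hx : x ∈ Ici (Real.log K)
    · rw [indicator_of_mem hx, max_eq_left]
      exact sub_nonneg.mpr ((Real.log_le_iff_le_exp hK).mp hx)
    · rw [indicator_of_notMem hx, max_eq_right]
      rw [mem_Ici, not_le] at hx
      exact sub_nonpos.mpr ((Real.lt_log_iff_exp_lt hK).mp hx).le
  simp_rw [h]
  rw [integral_indicator measurableSet_Ici, integral_sub hint.integrableOn (integrable_const K),
    black_shift m v hv, black_tail _ v hv, setIntegral_const, black_tail _ v hv, smul_eq_mul,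
    mul_comm K]
end
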